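/- Let ℓ be a prime and c an odd positive integer coprime to ℓ; let c₁ be the radical of c, i.e. the product of the distinct primes dividing c. Let Ω be an algebraic closure of ℚ_ℓ and ζ ∈ Ω a primitive c-th root of unity. Then there exists a ℚ_ℓ-algebra automorphism σ of Ω with σ(ζ) = ζ⁻¹ if and only if there exists a natural number r ≥ 1 such that c₁ divides ℓ^r + 1. -/

import Mathlib

open Polynomial

/-- A ring homomorphism between domains preserves primitive `n`-th roots of unity if `n` is
nonzero in the target. -/
theorem IsPrimitiveRoot.map_of_natCast_ne_zero {R S : Type*} [CommRing R] [IsDomain R]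
    [CommRing S] [IsDomain S] (f : R →+* S) {ζ : R} {n : ℕ} (hζ : IsPrimitiveRoot ζ n)
    (hn : (n : S) ≠ 0) : IsPrimitiveRoot (f ζ) n := by
  have hS : NeZero (n : S) := ⟨hn⟩
  have hR : NeZero (n : R) := ⟨fun h => hn (by rw [← map_natCast f, h, map_zero])⟩
  rw [← isRoot_cyclotomic_iff] at hζ ⊢
  rw [← map_cyclotomic n f]
  exact hζ.map

/-- In characteristic `p`, a field endomorphism sends an element of a finite subfield to
one of its iterated `p`-th powers. -/
theorem exists_map_eq_pow_char_pow {k : Type*} [Field k] {p : ℕ} [Fact p.Prime] [CharP k p]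
    (φ : k →+* k) {x : k} {n : ℕ} (hn : n ≠ 0) (hx : x ^ p ^ n = x) :
    ∃ i, φ x = x ^ p ^ i := by
  set h : k[X] := ∏ i ∈ Finset.range n, (X - C (x ^ p ^ i)) with hh
  have h_frob : h.map (frobenius k p) = h := by
    obtain ⟨m, rfl⟩ := Nat.exists_eq_succ_of_ne_zero hn
    rw [hh, Polynomial.map_prod, Finset.prod_range_succ, Finset.prod_range_succ']
    simp only [Polynomial.map_sub, map_X, map_C,
      frobenius_def, ← pow_mul, ← pow_succ, hx, pow_zero, pow_one]
  have h_map : h.map φ = h := by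
    ext j
    have hj : h.coeff j ∈ (⊥ : Subfield k) := by
      rw [Subfield.mem_bot_iff_pow_eq_self k p]
      conv_rhs => rw [← h_frob]
      simp [frobenius_def]
    rw [coeff_map]
    exact (bot_le : ⊥ ≤ φ.eqLocusField (RingHom.id k)) hj
  have h_root : h.eval x = 0 := by
    rw [hh, eval_prod]
    exact Finset.prod_eq_zero (Finset.mem_range.2 (Nat.pos_of_ne_zero hn)) (by simp)
  have h_root' : h.eval (φ x) = 0 := by
    rw [← h_map, eval_map_apply, h_root, map_zero]
  rw [hh, eval_prod, Finset.prod_eq_zero_iff] at h_root'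
  obtain ⟨i, -, hi⟩ := h_root'
  exact ⟨i, by simpa [sub_eq_zero] using hi⟩

/-- An odd number divides `ℓ ^ s + 1` for some `s` if its radical divides `ℓ ^ r + 1`
for some `r`. -/
theorem exists_dvd_pow_add_one_of_radical_dvd {c ℓ r : ℕ} (hodd : Odd c)
    (h : ∏ p ∈ c.primeFactors, p ∣ ℓ ^ r + 1) : ∃ s, c ∣ ℓ ^ s + 1 := by
  have hc : c ≠ 0 := hodd.pos.ne'
  set q := ∏ p ∈ c.primeFactors, p with hq
  have h_odd : Odd q := hodd.of_dvd_nat (Nat.prod_primeFactors_dvd c)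
  have hcq : c ∣ q ^ (c + 1) := by
    conv_lhs => rw [← Nat.prod_factorization_pow_eq_self hc]
    rw [hq, ← Finset.prod_pow]
    exact Finset.prod_dvd_prod_of_dvd _ _ fun p _ =>
      pow_dvd_pow p ((Nat.factorization_lt p hc).le.trans c.le_succ)
  have h_lift : ((q : ℤ)) ^ (c + 1) ∣ ((ℓ : ℤ) ^ r) ^ q ^ c - (-1) ^ q ^ c :=
    dvd_sub_pow_of_dvd_sub (by simpa using Int.natCast_dvd_natCast.2 h) c
  rw [h_odd.pow.neg_one_pow, sub_neg_eq_add, ← pow_mul] at h_lift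
  exact ⟨r * q ^ c, hcq.trans (by exact_mod_cast h_lift)⟩

open scoped NNReal

/-- The valuation on an algebraic extension of `ℚ_[ℓ]` given by the spectral norm. -/
theorem Padic.exists_valuation_extends (ℓ : ℕ) [Fact ℓ.Prime] (Ω : Type*) [Field Ω]
    [Algebra ℚ_[ℓ] Ω] [Algebra.IsAlgebraic ℚ_[ℓ] Ω] :
    ∃ v : Valuation Ω ℝ≥0, (∀ a : ℚ_[ℓ], v (algebraMap ℚ_[ℓ] Ω a) = ‖a‖₊) ∧
      ∀ (σ : Ω ≃ₐ[ℚ_[ℓ]] Ω) (x : Ω), v (σ x) = v x := by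
  let N := spectralMulAlgNorm ℚ_[ℓ] Ω
  refine ⟨{ toFun := fun x => ⟨N x, apply_nonneg N x⟩
            map_zero' := NNReal.eq (map_zero N)
            map_one' := NNReal.eq (map_one N)
            map_mul' := fun x y => NNReal.eq (map_mul N x y)
            map_add_le_max' := fun x y => isNonarchimedean_spectralNorm x y },
    fun a => NNReal.eq (spectralNorm_extends a),
    fun σ x => NNReal.eq (spectralNorm_eq_of_equiv σ x).symm⟩

section Padic

variable {ℓ : ℕ} [Fact ℓ.Prime] {Ω : Type*} [Field Ω] [Algebra ℚ_[ℓ] Ω] {v : Valuation Ω ℝ≥0}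

open IsLocalRing

/-- The residue field of a valuation extending the `ℓ`-adic one has characteristic `ℓ`. -/
theorem charP_residueField (hv : ∀ a : ℚ_[ℓ], v (algebraMap ℚ_[ℓ] Ω a) = ‖a‖₊) :
    CharP (ResidueField v.valuationSubring) ℓ := by
  rw [CharP.charP_iff_prime_eq_zero Fact.out, ← map_natCast (residue v.valuationSubring),
    residue_eq_zero_iff, Valuation.mem_maximalIdeal_iff]
  have h : v (ℓ : Ω) < 1 := by
    rw [← map_natCast (algebraMap ℚ_[ℓ] Ω), hv, ← NNReal.coe_lt_coe]
    exact Padic.norm_p_lt_one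
  exact_mod_cast h

theorem isPrimitiveRoot_residue (hv : ∀ a : ℚ_[ℓ], v (algebraMap ℚ_[ℓ] Ω a) = ‖a‖₊) {c : ℕ}
    (hcop : c.Coprime ℓ) {z : v.valuationSubring} (hz : IsPrimitiveRoot (z : Ω) c) :
    IsPrimitiveRoot (residue v.valuationSubring z) c := by
  have := charP_residueField hv
  have hz' : IsPrimitiveRoot z c :=
    IsPrimitiveRoot.of_map_of_injective (f := v.valuationSubring.subtype) hz
      Subtype.val_injective
  refine hz'.map_of_natCast_ne_zero _ fun h => ?_
  rw [CharP.cast_eq_zero_iff _ ℓ] at h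
  exact (Fact.out : ℓ.Prime).one_lt.ne' (Nat.eq_one_of_dvd_coprimes hcop h dvd_rfl)

theorem mem_valuationSubring_of_pow_eq_one {x : Ω} {c : ℕ} (hc : c ≠ 0) (hx : x ^ c = 1) :
    x ∈ v.valuationSubring := by
  rw [Valuation.mem_valuationSubring_iff, ← pow_le_one_iff hc, ← map_pow, hx, map_one]

/-- An automorphism inverting a primitive `c`-th root of unity acts on the residue field by
inverting its reduction, so `-1` is a power of `ℓ` modulo `c`. -/
theorem exists_dvd_pow_add_one_of_map_eq_inv
    (hv : ∀ a : ℚ_[ℓ], v (algebraMap ℚ_[ℓ] Ω a) = ‖a‖₊) {c : ℕ} (hc : c ≠ 0)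
    (hcop : c.Coprime ℓ) {ζ : Ω} (hζ : IsPrimitiveRoot ζ c) (σ : Ω ≃ₐ[ℚ_[ℓ]] Ω)
    (hσ : ∀ x, v (σ x) = v x) (h_inv : σ ζ = ζ⁻¹) : ∃ s, c ∣ ℓ ^ s + 1 := by
  have := charP_residueField hv
  let z : v.valuationSubring := ⟨ζ, mem_valuationSubring_of_pow_eq_one hc hζ.pow_eq_one⟩
  have hz : IsPrimitiveRoot (residue _ z) c := isPrimitiveRoot_residue hv hcop hζ
  let τ : v.valuationSubring →+* v.valuationSubring :=
    (σ : Ω →+* Ω).restrict v.valuationSubring v.valuationSubring fun x hx => by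
      rw [Valuation.mem_valuationSubring_iff] at hx ⊢
      exact (hσ x).trans_le hx
  have hτ : τ z * z = 1 := by
    refine Subtype.ext ?_
    change σ ζ * ζ = 1
    rw [h_inv, inv_mul_cancel₀ (hζ.ne_zero hc)]
  have : IsLocalHom τ := ((local_hom_TFAE τ).out 0 3).2 <| by
    intro x hx
    have hx' : v (x : Ω) < 1 := (Valuation.mem_maximalIdeal_iff _ v).1 hx
    exact (Valuation.mem_maximalIdeal_iff _ v).2 ((hσ x).trans_lt hx')
  obtain ⟨i, hi⟩ := exists_map_eq_pow_char_pow (p := ℓ) (ResidueField.map τ)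
    (x := residue _ z) (n := c.totient) (Nat.totient_pos.2 (Nat.pos_of_ne_zero hc)).ne' (by
      simpa using pow_eq_pow_of_modEq (Nat.ModEq.pow_totient hcop.symm) hz.pow_eq_one)
  refine ⟨i, hz.dvd_of_pow_eq_one _ ?_⟩
  rw [pow_succ, ← hi, ResidueField.map_residue, ← map_mul, hτ, map_one]

/-- Frobenius: `ζ ^ ℓ` is conjugate to `ζ` over `ℚ_[ℓ]` for a root of unity `ζ` of order
prime to `ℓ`. -/
theorem exists_algEquiv_map_eq_pow_prime [IsAlgClosure ℚ_[ℓ] Ω]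
    (hv : ∀ a : ℚ_[ℓ], v (algebraMap ℚ_[ℓ] Ω a) = ‖a‖₊) {c : ℕ} (hc : c ≠ 0)
    (hcop : c.Coprime ℓ) {ζ : Ω} (hζ : IsPrimitiveRoot ζ c) :
    ∃ σ : Ω ≃ₐ[ℚ_[ℓ]] Ω, σ ζ = ζ ^ ℓ := by
  have := charP_residueField hv
  have : Algebra.IsAlgebraic ℚ_[ℓ] Ω := IsAlgClosure.isAlgebraic
  have : IsAlgClosed Ω := IsAlgClosure.isAlgClosed ℚ_[ℓ]
  have : Normal ℚ_[ℓ] Ω := IsAlgClosure.normal ℚ_[ℓ] Ω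
  have h_mem (a : ℤ_[ℓ]) : algebraMap ℚ_[ℓ] Ω a ∈ v.valuationSubring := by
    rw [Valuation.mem_valuationSubring_iff, hv, ← NNReal.coe_le_coe]
    exact a.2
  let ι : ℤ_[ℓ] →+* v.valuationSubring :=
    ((algebraMap ℚ_[ℓ] Ω).comp PadicInt.Coe.ringHom).codRestrict v.valuationSubring h_mem
  let ψ : ℤ_[ℓ] →+* ResidueField v.valuationSubring := (residue _).comp ι
  have hψ (a : ℤ_[ℓ]) : ψ a ^ ℓ = ψ a := by
    have ha : a ^ ℓ - a ∈ maximalIdeal ℤ_[ℓ] := by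
      rw [← PadicInt.ker_toZMod, RingHom.mem_ker, map_sub, map_pow, ZMod.pow_card, sub_self]
    rw [PadicInt.maximalIdeal_eq_span_p, Ideal.mem_span_singleton] at ha
    obtain ⟨b, hb⟩ := ha
    rw [← sub_eq_zero, ← map_pow, ← map_sub, hb, map_mul, map_natCast, CharP.cast_eq_zero,
      zero_mul]
  have h_int : IsIntegral ℚ_[ℓ] ζ := Algebra.IsIntegral.isIntegral ζ
  let z : v.valuationSubring := ⟨ζ, mem_valuationSubring_of_pow_eq_one hc hζ.pow_eq_one⟩
  have hz : IsPrimitiveRoot (residue _ z) c := isPrimitiveRoot_residue hv hcop hζ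
  obtain ⟨F, hF⟩ : ∃ F : ℤ_[ℓ][X], minpoly ℚ_[ℓ] ζ = F.map PadicInt.Coe.ringHom := by
    let : Algebra ℤ_[ℓ] Ω := ((algebraMap ℚ_[ℓ] Ω).comp (algebraMap ℤ_[ℓ] ℚ_[ℓ])).toAlgebra
    have : IsScalarTower ℤ_[ℓ] ℚ_[ℓ] Ω := .of_algebraMap_eq fun _ => rfl
    have h_int' : IsIntegral ℤ_[ℓ] ζ :=
      .of_pow (Nat.pos_of_ne_zero hc) (hζ.pow_eq_one ▸ isIntegral_one)
    exact ⟨minpoly ℤ_[ℓ] ζ, minpoly.isIntegrallyClosed_eq_field_fractions' ℚ_[ℓ] h_int'⟩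
  have h_eval (y : v.valuationSubring) :
      aeval (y : Ω) (minpoly ℚ_[ℓ] ζ) = (F.eval₂ ι y : v.valuationSubring) := by
    rw [hF, aeval_def, eval₂_map]
    exact (hom_eval₂ F ι v.valuationSubring.subtype y).symm
  have hFz : (F.map ψ).eval (residue _ z) = 0 := by
    rw [eval_map, ← hom_eval₂]
    have : F.eval₂ ι z = 0 := Subtype.ext ((h_eval z).symm.trans (minpoly.aeval _ _))
    rw [this, map_zero]
  have hFzl : (F.map ψ).eval (residue _ (z ^ ℓ)) = 0 := by
    have h_frob : (F.map ψ).map (frobenius _ ℓ) = F.map ψ := by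
      ext j
      simp [frobenius_def, hψ]
    rw [map_pow, ← frobenius_def, ← h_frob, eval_map_apply, hFz, map_zero]
  have h_lt : v (aeval (ζ ^ ℓ) (minpoly ℚ_[ℓ] ζ)) < 1 := by
    rw [eval_map, ← hom_eval₂, residue_eq_zero_iff, Valuation.mem_maximalIdeal_iff] at hFzl
    have := h_eval (z ^ ℓ)
    rw [← this] at hFzl
    exact hFzl
  obtain ⟨ρ, hρ, hρ_lt⟩ : ∃ ρ, aeval ρ (minpoly ℚ_[ℓ] ζ) = 0 ∧ v (ζ ^ ℓ - ρ) < 1 := by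
    by_contra! h
    refine h_lt.not_ge ?_
    rw [aeval_def, ← eval_map, (IsAlgClosed.splits _).eval_eq_prod_roots_of_monic
      ((minpoly.monic h_int).map _), map_multiset_prod, Multiset.map_map]
    refine Multiset.one_le_prod_of_one_le fun x hx => ?_
    obtain ⟨ρ, hρ, rfl⟩ := Multiset.mem_map.1 hx
    refine h ρ ?_
    rw [aeval_def, ← eval_map]
    exact isRoot_of_mem_roots hρ
  obtain ⟨σ, hσ⟩ := minpoly.exists_algEquiv_of_root h_int.isAlgebraic hρ
  have hρ_pow : ρ ^ c = 1 := σ.injective (by rw [map_pow, hσ, hζ.pow_eq_one, map_one])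
  have : NeZero c := ⟨hc⟩
  obtain ⟨i, hi, rfl⟩ := hζ.eq_pow_of_pow_eq_one hρ_pow
  obtain ⟨j, hj, hj_eq⟩ := hζ.eq_pow_of_pow_eq_one (ξ := ζ ^ ℓ)
    (by rw [pow_right_comm, hζ.pow_eq_one, one_pow])
  rw [← hj_eq] at hρ_lt ⊢
  have h_res : residue _ z ^ j = residue _ z ^ i := by
    rw [← sub_eq_zero, ← map_pow, ← map_pow, ← map_sub, residue_eq_zero_iff,
      Valuation.mem_maximalIdeal_iff]
    exact hρ_lt
  obtain rfl := hz.pow_inj hj hi h_res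
  exact ⟨σ.symm, by rw [← hσ, AlgEquiv.symm_apply_apply, hσ]⟩

end Padic

/-- for a prime `ℓ` and an odd positive `c` coprime to `ℓ`, a primitive
`c`-th root of unity `ζ` in an algebraic closure `Ω` of `ℚ_ℓ` is conjugate to `ζ⁻¹`
over `ℚ_ℓ` iff `c₁ ∣ ℓ^r + 1` for some `r ≥ 1`, where `c₁` is the radical of `c`. -/
theorem stmt9 (ℓ : ℕ) [Fact ℓ.Prime]
    (c : ℕ) (hc : 0 < c) (hodd : Odd c) (hcop : Nat.Coprime c ℓ)
    (c₁ : ℕ) (hc₁ : c₁ = ∏ p ∈ c.primeFactors, p)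
    (Ω : Type*) [Field Ω] [Algebra ℚ_[ℓ] Ω] [IsAlgClosure ℚ_[ℓ] Ω]
    (ζ : Ω) (hζ : IsPrimitiveRoot ζ c) :
    (∃ σ : Ω ≃ₐ[ℚ_[ℓ]] Ω, σ ζ = ζ⁻¹) ↔ ∃ r : ℕ, 1 ≤ r ∧ c₁ ∣ ℓ ^ r + 1 := by
  have : Algebra.IsAlgebraic ℚ_[ℓ] Ω := IsAlgClosure.isAlgebraic
  obtain ⟨v, hv, hσv⟩ := Padic.exists_valuation_extends ℓ Ω
  constructor
  · rintro ⟨σ, hσ⟩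
    obtain ⟨s, hs⟩ := exists_dvd_pow_add_one_of_map_eq_inv hv hc.ne' hcop hζ σ (hσv σ) hσ
    have hs₁ : c₁ ∣ ℓ ^ s + 1 := (hc₁ ▸ Nat.prod_primeFactors_dvd c).trans hs
    rcases Nat.eq_zero_or_pos s with rfl | h_pos
    · have h2 : c ∣ 2 := by simpa using hs
      obtain rfl : c = 1 := Nat.eq_one_of_dvd_coprimes hodd.coprime_two_right dvd_rfl h2
      exact ⟨1, le_rfl, by simp [hc₁]⟩
    · exact ⟨s, h_pos, hs₁⟩
  · rintro ⟨r, -, hr⟩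
    obtain ⟨s, hs⟩ := exists_dvd_pow_add_one_of_radical_dvd hodd (hc₁ ▸ hr)
    obtain ⟨φ, hφ⟩ := exists_algEquiv_map_eq_pow_prime hv hc.ne' hcop hζ
    have h_iter : ∀ j : ℕ, (φ ^ j) ζ = ζ ^ ℓ ^ j := by
      intro j
      induction j with
      | zero => simp
      | succ j ih => rw [pow_succ, AlgEquiv.mul_apply, hφ, map_pow, ih, ← pow_mul, ← pow_succ]
    refine ⟨φ ^ s, eq_inv_of_mul_eq_one_left ?_⟩
    rw [h_iter, ← pow_succ, hζ.pow_eq_one_iff_dvd]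
    exact hs
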